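/- arXiv:2409.14468 — 2 statements merged into one kernel-verified Lean document; each statement's English description precedes it below -/
import Mathlib

section
/- Let a > 0, β > 2, and let (p_N) be a sequence in [0,1] with N^β·p_N → a as N → ∞ (i.e., p_N ~ a/N^β). Let (Ω, F, P) be any probability space carrying, for each N, a random variable X_N whose distribution equals that of T(N; 1 − p_N). Then X_N → 1 almost surely as N → ∞. -/
/-- Binary search test count. -/
def T : (n : ℕ) → (Fin n → Bool) → ℕ
  | 0, _ => 1
  | 1, _ => 1
  | n + 2, v =>
    if ∀ i, v i = false then 1
    else
      1 + T ((n + 2) / 2) (fun i => v ⟨i.1, by have := i.2; omega⟩)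
        + T (n + 2 - (n + 2) / 2) (fun i => v ⟨(n + 2) / 2 + i.1, by have := i.2; omega⟩)
termination_by n _ => n
decreasing_by all_goals omega

/-- Expectation of f under the i.i.d. Bernoulli(p) product measure on {0,1}^n. -/
noncomputable def expect (n : ℕ) (p : ℝ) (f : (Fin n → Bool) → ℝ) : ℝ :=
  ∑ v : Fin n → Bool, (∏ i, if v i then p else 1 - p) * f v

noncomputable def ET (n : ℕ) (p : ℝ) : ℝ := expect n p fun v => (T n v : ℝ)

noncomputable def varT (n : ℕ) (p : ℝ) : ℝ :=
  expect n p fun v => ((T n v : ℝ) - ET n p) ^ 2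

open Classical in
/-- Probability of the event A under the i.i.d. Bernoulli(p) product measure. -/
noncomputable def prob (n : ℕ) (p : ℝ) (A : (Fin n → Bool) → Prop) : ℝ :=
  ∑ v : Fin n → Bool, if A v then (∏ i, if v i then p else 1 - p) else 0

open MeasureTheory in
/-- The law on ℝ of the test count `T(n; 1-p)` under the i.i.d. Bernoulli(p)
product measure on `{0,1}^n`: a weighted sum of Dirac masses. -/
noncomputable def lawT (n : ℕ) (p : ℝ) : Measure ℝ :=
  ∑ v : Fin n → Bool,
    (ENNReal.ofReal (∏ i, if v i then p else 1 - p)) • Measure.dirac ((T n v : ℝ))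

lemma T_eq_one_of_forall_eq_false (n : ℕ) (v : Fin n → Bool) (hv : ∀ i, v i = false) :
    T n v = 1 := by
  match n, v with
  | 0, _ => simp [T]
  | 1, _ => simp [T]
  | n + 2, v => rw [T, if_pos hv]

open MeasureTheory in
lemma ofReal_one_sub_pow_le_lawT_singleton_one (n : ℕ) (p : ℝ) :
    ENNReal.ofReal ((1 - p) ^ n) ≤ lawT n p {1} := by
  have h := Finset.single_le_sum (f := fun v : Fin n → Bool =>
    (ENNReal.ofReal (∏ i, if v i then p else 1 - p)) * Measure.dirac ((T n v : ℝ)) {1})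
    (fun _ _ => zero_le) (Finset.mem_univ fun _ => false)
  simpa [lawT, T_eq_one_of_forall_eq_false] using h

/-- The union bound: the test count differs from `1` only if some entry is nonzero. -/
lemma lawT_compl_singleton_one_le (n : ℕ) {p : ℝ} (hp : p ∈ Set.Icc (0 : ℝ) 1)
    [MeasureTheory.IsProbabilityMeasure (lawT n p)] :
    lawT n p {1}ᶜ ≤ ENNReal.ofReal (n * p) := by
  rw [MeasureTheory.prob_compl_eq_one_sub (MeasurableSet.singleton 1), tsub_le_iff_right]
  have bernoulli : 1 ≤ n * p + (1 - p) ^ n := by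
    have := one_add_mul_le_pow (a := -p) (by linarith [hp.2]) n
    rw [← sub_eq_add_neg] at this
    linarith
  calc (1 : ENNReal) ≤ ENNReal.ofReal (n * p + (1 - p) ^ n) := by simpa using bernoulli
    _ ≤ ENNReal.ofReal (n * p) + ENNReal.ofReal ((1 - p) ^ n) := ENNReal.ofReal_add_le
    _ ≤ _ := by gcongr; exact ofReal_one_sub_pow_le_lawT_singleton_one n p

lemma summable_natCast_mul_of_tendsto_rpow_mul {a β : ℝ} (hβ : 2 < β) {p : ℕ → ℝ}
    (hlim : Filter.Tendsto (fun N : ℕ => (N : ℝ) ^ β * p N) Filter.atTop (nhds a)) :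
    Summable fun N : ℕ => (N : ℝ) * p N := by
  refine summable_of_isBigO_nat (Real.summable_nat_rpow.2 (by linarith : 1 - β < -1)) ?_
  have h := (Asymptotics.isBigO_refl (fun N : ℕ => (N : ℝ) ^ (1 - β)) Filter.atTop).mul
    (hlim.isBigO_one ℝ)
  refine h.congr' ?_ (by simp)
  filter_upwards [Filter.eventually_gt_atTop 0] with N hN
  have hN' : (0 : ℝ) < N := by exact_mod_cast hN
  rw [← mul_assoc, ← Real.rpow_add hN', sub_add_cancel, Real.rpow_one]


open MeasureTheory in
/-- Remark 1 (second part): if `β > 2` and `N^β * p_N → a > 0`, and `X_N` are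
random variables on any probability space with `X_N` distributed as
`T(N; 1 - p_N)`, then `X_N → 1` almost surely. -/
theorem T_tendsto_one_almost_surely (a β : ℝ) (ha : 0 < a) (hβ : 2 < β)
    (p : ℕ → ℝ) (hp : ∀ N, p N ∈ Set.Icc (0 : ℝ) 1)
    (hlim : Filter.Tendsto (fun N : ℕ => (N : ℝ) ^ β * p N) Filter.atTop (nhds a))
    {Ω : Type*} [MeasurableSpace Ω] (P : Measure Ω) [IsProbabilityMeasure P]
    (X : ℕ → Ω → ℝ) (hXm : ∀ N, Measurable (X N))
    (hlaw : ∀ N, Measure.map (X N) P = lawT N (p N)) :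
    ∀ᵐ ω ∂P, Filter.Tendsto (fun N => X N ω) Filter.atTop (nhds 1) := by
  have meas (N : ℕ) : P {ω | X N ω ≠ 1} ≤ ENNReal.ofReal (N * p N) := by
    have : IsProbabilityMeasure (lawT N (p N)) :=
      hlaw N ▸ Measure.isProbabilityMeasure_map (hXm N).aemeasurable
    calc P {ω | X N ω ≠ 1} = Measure.map (X N) P {1}ᶜ :=
          (Measure.map_apply (hXm N) (MeasurableSet.singleton 1).compl).symm
      _ ≤ _ := hlaw N ▸ lawT_compl_singleton_one_le N (hp N)
  have sum_ne_top : ∑' N, P {ω | X N ω ≠ 1} ≠ ⊤ :=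
    ne_top_of_le_ne_top (summable_natCast_mul_of_tendsto_rpow_mul hβ hlim).tsum_ofReal_ne_top
      (ENNReal.tsum_le_tsum meas)
  filter_upwards [ae_eventually_notMem sum_ne_top] with ω hω
  refine tendsto_const_nhds.congr' ?_
  filter_upwards [hω] with N hN
  simpa [eq_comm] using hN
end

section
/- Let a > 0, β > 1, and for each N ≥ 1 set p_N := a/N^β (assume N large enough that p_N ∈ [0,1]). Then V[T(N)] = O((ln N)²/N^{β−1}) as N → ∞; consequently E[(T(N) − 1)²] → 0, i.e., T(N) converges to the constant 1 in the L² sense, where T(N) = T(N; 1 − p_N). -/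
theorem sum_fin_split {m k n : ℕ} (h : m + k = n) (f : Fin n → ℕ) :
    ∑ i, f i = ∑ i : Fin m, f ⟨i.1, by have := i.2; omega⟩
      + ∑ i : Fin k, f ⟨m + i.1, by have := i.2; omega⟩ := by
  subst h
  rw [Fin.sum_univ_add]
  rfl

theorem one_le_T (n : ℕ) (v : Fin n → Bool) : 1 ≤ T n v := by
  match n, v with
  | 0, _ => simp [T]
  | 1, _ => simp [T]
  | n + 2, v =>
    rw [T]
    split_ifs <;> omega

/-- Each positive entry costs at most two tests per level of the search. -/
theorem T_le (k : ℕ) : ∀ (n : ℕ) (v : Fin n → Bool), n ≤ 2 ^ k →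
    T n v ≤ 1 + 2 * k * ∑ i, (v i).toNat := by
  induction k with
  | zero =>
    intro n v h
    match n, v, h with
    | 0, _, _ => simp [T]
    | 1, _, _ => simp [T]
  | succ k ih =>
    intro n v h
    match n, v, h with
    | 0, _, _ => simp [T]
    | 1, _, _ => simp [T]
    | n + 2, v, h =>
      rw [T]
      split_ifs with hv
      · omega
      · have h₁ := ih ((n + 2) / 2) (fun i => v ⟨i.1, by have := i.2; omega⟩) (by omega)
        have h₂ := ih (n + 2 - (n + 2) / 2)
          (fun i => v ⟨(n + 2) / 2 + i.1, by have := i.2; omega⟩) (by omega)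
        have hs := sum_fin_split (m := (n + 2) / 2) (k := n + 2 - (n + 2) / 2) (by omega)
          (fun i => (v i).toNat)
        have hpos : 1 ≤ ∑ i, (v i).toNat := by
          push Not at hv
          obtain ⟨i, hi⟩ := hv
          refine le_trans ?_
            (Finset.single_le_sum (fun j _ => Nat.zero_le (v j).toNat) (Finset.mem_univ i))
          simp [Bool.eq_true_of_not_eq_false hi]
        nlinarith

theorem expect_add (n : ℕ) (p : ℝ) (f g : (Fin n → Bool) → ℝ) :
    expect n p (fun v => f v + g v) = expect n p f + expect n p g := by
  simp [expect, mul_add, Finset.sum_add_distrib]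

theorem expect_const_mul (n : ℕ) (p c : ℝ) (f : (Fin n → Bool) → ℝ) :
    expect n p (fun v => c * f v) = c * expect n p f := by
  simp only [expect, Finset.mul_sum]
  exact Finset.sum_congr rfl fun _ _ => by ring

theorem expect_mono {n : ℕ} {p : ℝ} (hp₀ : 0 ≤ p) (hp₁ : p ≤ 1) {f g : (Fin n → Bool) → ℝ}
    (h : ∀ v, f v ≤ g v) : expect n p f ≤ expect n p g := by
  refine Finset.sum_le_sum fun v _ => mul_le_mul_of_nonneg_left (h v) ?_
  refine Finset.prod_nonneg fun i _ => ?_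
  split_ifs <;> linarith

theorem expect_nonneg {n : ℕ} {p : ℝ} (hp₀ : 0 ≤ p) (hp₁ : p ≤ 1) {f : (Fin n → Bool) → ℝ}
    (h : ∀ v, 0 ≤ f v) : 0 ≤ expect n p f := by
  simpa [expect] using expect_mono hp₀ hp₁ h

theorem expect_succ (n : ℕ) (p : ℝ) (f : (Fin (n + 1) → Bool) → ℝ) :
    expect (n + 1) p f = p * expect n p (fun v => f (Fin.cons true v))
      + (1 - p) * expect n p (fun v => f (Fin.cons false v)) := by
  simp only [expect]
  rw [← (Fin.consEquiv fun _ : Fin (n + 1) => Bool).sum_comp, Fintype.sum_prod_type]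
  simp [Fin.consEquiv, Fin.prod_univ_succ, Finset.mul_sum, mul_assoc]

theorem expect_one (n : ℕ) (p : ℝ) : expect n p (fun _ => 1) = 1 := by
  induction n with
  | zero => simp [expect]
  | succ n ih => rw [expect_succ, ih]; ring

theorem expect_sum_toNat (n : ℕ) (p : ℝ) :
    expect n p (fun v => ∑ i, ((v i).toNat : ℝ)) = n * p := by
  induction n with
  | zero => simp [expect]
  | succ n ih =>
    rw [expect_succ]
    simp only [Fin.sum_univ_succ, Fin.cons_zero, Fin.cons_succ, Bool.toNat_true, Bool.toNat_false,
      Nat.cast_one, Nat.cast_zero, zero_add, expect_add, expect_one, ih]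
    push_cast
    ring

theorem expect_sq_sum_toNat (n : ℕ) (p : ℝ) :
    expect n p (fun v => (∑ i, ((v i).toNat : ℝ)) ^ 2) = n * p * (1 - p) + (n * p) ^ 2 := by
  induction n with
  | zero => simp [expect]
  | succ n ih =>
    rw [expect_succ]
    simp only [Fin.sum_univ_succ, Fin.cons_zero, Fin.cons_succ, Bool.toNat_true, Bool.toNat_false,
      Nat.cast_one, Nat.cast_zero, zero_add, add_sq, one_pow, mul_one, expect_add, expect_one,
      expect_const_mul, expect_sum_toNat, ih]
    push_cast
    ring

theorem expect_sq_sub_eq (n : ℕ) (p c : ℝ) (f : (Fin n → Bool) → ℝ) :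
    expect n p (fun v => (f v - c) ^ 2)
      = expect n p (fun v => (f v - expect n p f) ^ 2) + (expect n p f - c) ^ 2 := by
  have h : ∀ d : ℝ, expect n p (fun v => (f v - d) ^ 2)
      = expect n p (fun v => f v ^ 2) + (-2 * d) * expect n p f + d ^ 2 := by
    intro d
    have : (fun v => (f v - d) ^ 2) = fun v => f v ^ 2 + (-2 * d) * f v + d ^ 2 * 1 := by
      funext v; ring
    rw [this, expect_add, expect_add, expect_const_mul, expect_const_mul, expect_one, mul_one]
  rw [h, h]
  ring

theorem expect_sq_T_sub_one_le {n k : ℕ} (hn : n ≤ 2 ^ k) {p : ℝ} (hp₀ : 0 ≤ p) (hp₁ : p ≤ 1) :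
    expect n p (fun v => ((T n v : ℝ) - 1) ^ 2)
      ≤ (2 * k) ^ 2 * (n * p + (n * p) ^ 2) := by
  calc
    _ ≤ expect n p (fun v => (2 * k : ℝ) ^ 2 * (∑ i, ((v i).toNat : ℝ)) ^ 2) := by
      refine expect_mono hp₀ hp₁ fun v => ?_
      rw [← mul_pow]
      have h₁ : (1 : ℝ) ≤ T n v := by exact_mod_cast one_le_T n v
      have h₂ : (T n v : ℝ) ≤ 1 + 2 * k * ∑ i, ((v i).toNat : ℝ) := by
        exact_mod_cast T_le k n v hn
      exact pow_le_pow_left₀ (by linarith) (by linarith) 2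
    _ ≤ _ := by
      rw [expect_const_mul, expect_sq_sum_toNat]
      have : 0 ≤ n * p * p := by positivity
      refine mul_le_mul_of_nonneg_left ?_ (by positivity)
      linarith

theorem natLog_two_add_one_le {n : ℕ} (hn : 3 ≤ n) :
    ((Nat.log 2 n + 1 : ℕ) : ℝ) ≤ 3 * Real.log n := by
  have hn' : (3 : ℝ) ≤ n := by exact_mod_cast hn
  have h₁ : 1 ≤ Real.log n := by
    rw [Real.le_log_iff_exp_le (by linarith)]
    linarith [Real.exp_one_lt_d9]
  have h₂ : Nat.log 2 n * Real.log 2 ≤ Real.log n := by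
    rw [← Real.log_pow]
    refine Real.log_le_log (by positivity) ?_
    exact_mod_cast Nat.pow_log_le_self 2 (by omega)
  have h₃ := Real.log_two_gt_d9
  have h₄ : (0 : ℝ) ≤ Nat.log 2 n := by positivity
  push_cast
  nlinarith

theorem eventually_expect_sq_T_sub_one_le {a β : ℝ} (ha : 0 < a) (hβ : 1 < β) :
    ∀ᶠ N : ℕ in Filter.atTop, 0 ≤ a / (N : ℝ) ^ β ∧ a / (N : ℝ) ^ β ≤ 1 ∧
      expect N (a / (N : ℝ) ^ β) (fun v => ((T N v : ℝ) - 1) ^ 2)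
        ≤ 72 * a * (Real.log N) ^ 2 / (N : ℝ) ^ (β - 1) := by
  have hlim := (tendsto_rpow_atTop (sub_pos.2 hβ)).comp (tendsto_natCast_atTop_atTop (R := ℝ))
  filter_upwards [hlim.eventually_ge_atTop a, Filter.eventually_ge_atTop 3] with N hN hN₃
  simp only [Function.comp_apply] at hN
  have hN' : (3 : ℝ) ≤ N := by exact_mod_cast hN₃
  have hN₀ : (0 : ℝ) < N := by linarith
  have hpow : 0 < (N : ℝ) ^ (β - 1) := Real.rpow_pos_of_pos hN₀ _
  have hβN : (N : ℝ) ^ β = (N : ℝ) ^ (β - 1) * N := by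
    rw [← Real.rpow_add_one hN₀.ne', sub_add_cancel]
  have hp₀ : 0 ≤ a / (N : ℝ) ^ β := by positivity
  have hp₁ : a / (N : ℝ) ^ β ≤ 1 := by
    rw [div_le_one (by positivity), hβN]
    nlinarith
  refine ⟨hp₀, hp₁, (expect_sq_T_sub_one_le (Nat.lt_pow_succ_log_self (b := 2) (by norm_num) N).le
    hp₀ hp₁).trans ?_⟩
  have hmul : N * (a / (N : ℝ) ^ β) = a / (N : ℝ) ^ (β - 1) := by
    rw [hβN]
    field_simp
  rw [hmul]
  set x := a / (N : ℝ) ^ (β - 1) with hx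
  have hx₀ : 0 ≤ x := by positivity
  have hx₁ : x ≤ 1 := (div_le_one hpow).2 hN
  calc
    _ ≤ (2 * (3 * Real.log N)) ^ 2 * (x + x) := by
      gcongr
      · exact natLog_two_add_one_le hN₃
      · nlinarith
    _ = _ := by
      rw [hx]
      ring

theorem tendsto_log_sq_div_rpow {s : ℝ} (hs : 0 < s) (c : ℝ) :
    Filter.Tendsto (fun N : ℕ => c * (Real.log N) ^ 2 / (N : ℝ) ^ s) Filter.atTop (nhds 0) := by
  have h := (isLittleO_log_rpow_rpow_atTop 2 hs).tendsto_div_nhds_zero.comp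
    (tendsto_natCast_atTop_atTop (R := ℝ))
  simpa [Function.comp_def, mul_div_assoc] using h.const_mul c

/-- Proposition 5: if `p_N = a / N^β` with `β > 1`, then
`V[T(N)] = O((ln N)²/N^{β-1})`; consequently `E[(T(N) - 1)²] → 0`, i.e.
`T(N) → 1` in the `L²` sense. -/
theorem variance_beta_gt_one (a β : ℝ) (ha : 0 < a) (hβ : 1 < β) :
    (∃ C > 0, ∃ N₀ : ℕ, ∀ N ≥ N₀,
        |varT N (a / (N : ℝ) ^ β)| ≤ C * (Real.log N) ^ 2 / (N : ℝ) ^ (β - 1)) ∧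
    Filter.Tendsto
      (fun N : ℕ => expect N (a / (N : ℝ) ^ β) (fun v => ((T N v : ℝ) - 1) ^ 2))
      Filter.atTop (nhds 0) := by
  have hev := eventually_expect_sq_T_sub_one_le ha hβ
  constructor
  · obtain ⟨N₀, hN₀⟩ := Filter.eventually_atTop.1 hev
    refine ⟨72 * a, by positivity, N₀, fun N hN => ?_⟩
    obtain ⟨hp₀, hp₁, hle⟩ := hN₀ N hN
    rw [varT, abs_of_nonneg (expect_nonneg hp₀ hp₁ fun v => sq_nonneg _)]
    refine le_trans ?_ hle
    rw [expect_sq_sub_eq N _ 1, ET]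
    exact le_add_of_nonneg_right (sq_nonneg _)
  · refine squeeze_zero' ?_ ?_ (tendsto_log_sq_div_rpow (sub_pos.2 hβ) (72 * a))
    · filter_upwards [hev] with N hN
      exact expect_nonneg hN.1 hN.2.1 fun v => sq_nonneg _
    · filter_upwards [hev] with N hN
      exact hN.2.2
end
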